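/- Let f : ℕ → ℕ be computable and unbounded, and define g : ℕ → ℕ by g(0) = f(0) and g(n+1) = f(μk.(f(k) > g(n))). Then for every A ∈ 2^ω, if A∘f is Martin-Löf random then A∘g is Martin-Löf random. -/

import Mathlib

open MeasureTheory

/-- Cantor space `2^ω`: functions from `ℕ` to `Bool`. -/
abbrev Cantor : Type := ℕ → Bool

/-- The fair-coin product measure on Cantor space (each bit is `true` with probability 1/2,
independently), realized concretely as the pushforward of Lebesgue measure on `[0,1)`
under the binary-digit map `x ↦ (n ↦ n-th binary digit of x)`. -/
noncomputable def fairCoin : Measure Cantor :=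
  Measure.map (fun (x : ℝ) (n : ℕ) => decide ((⌊x * 2 ^ (n + 1)⌋ % 2 : ℤ) = 1))
    (volume.restrict (Set.Ico (0 : ℝ) 1))

/-- The cylinder `[σ]` of all `X ∈ 2^ω` extending the finite binary string `σ`. -/
def cylinder (σ : List Bool) : Set Cantor :=
  {X | ∀ (i : ℕ) (h : i < σ.length), X i = σ.get ⟨i, h⟩}

/-- The `n`-th level `U_n` of a test `U`: the union of the cylinders enumerated by `U n`. -/
def testSet (U : ℕ → ℕ → Option (List Bool)) (n : ℕ) : Set Cantor :=
  ⋃ σ ∈ {σ : List Bool | ∃ k, U n k = some σ}, cylinder σ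

/-- A Martin-Löf test: a computable enumeration of cylinders with `μ(U_n) ≤ 2^{-n}`. -/
def MLTest (U : ℕ → ℕ → Option (List Bool)) : Prop :=
  Computable₂ U ∧ ∀ n, fairCoin (testSet U n) ≤ ((2 : ENNReal) ^ n)⁻¹

/-- The Martin-Löf random elements of Cantor space. -/
def MLR : Set Cantor :=
  {X | ∀ U : ℕ → ℕ → Option (List Bool), MLTest U → ∃ n, X ∉ testSet U n}


/-- The binary digit map. -/
noncomputable def digitMap (x : ℝ) (n : ℕ) : Bool :=
  decide ((⌊x * 2 ^ (n + 1)⌋ % 2 : ℤ) = 1)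

lemma measurable_digitMap : Measurable digitMap := by
  refine measurable_pi_iff.2 fun n => ?_
  have h1 : Measurable (fun x : ℝ => ⌊x * 2 ^ (n + 1)⌋) :=
    Int.measurable_floor.comp (measurable_id.mul_const _)
  exact (Measurable.of_discrete (f := fun z : ℤ => decide (z % 2 = 1))).comp h1

lemma digit_prefix (X : Cantor) (n : ℕ) : ∃ m : ℤ, 0 ≤ m ∧ m < 2 ^ n ∧
    ∀ x ∈ Set.Ico (0 : ℝ) 1, (∀ i < n, digitMap x i = X i) ↔ ⌊x * 2 ^ n⌋ = m := by
  induction n with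
  | zero =>
    refine ⟨0, le_rfl, by norm_num, fun x hx => ?_⟩
    simpa [Int.floor_eq_iff] using hx
  | succ n ih =>
    obtain ⟨m, h0, h1, h⟩ := ih
    refine ⟨2 * m + (if X n then 1 else 0), by split_ifs <;> omega, ?_, fun x hx => ?_⟩
    · rw [pow_succ]; split_ifs <;> omega
    · have e : (∀ i < n + 1, digitMap x i = X i) ↔
          (∀ i < n, digitMap x i = X i) ∧ digitMap x n = X n := Nat.forall_lt_succ_right
      rw [e, h x hx]
      have a1 : 2 * ⌊x * 2 ^ n⌋ ≤ ⌊x * 2 ^ (n + 1)⌋ := by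
        rw [Int.le_floor]; push_cast
        have := Int.floor_le (x * 2 ^ n)
        rw [pow_succ]; linarith
      have a2 : ⌊x * 2 ^ (n + 1)⌋ < 2 * ⌊x * 2 ^ n⌋ + 2 := by
        rw [Int.floor_lt]; push_cast
        have := Int.lt_floor_add_one (x * 2 ^ n)
        rw [pow_succ]; linarith
      unfold digitMap
      cases X n <;> simp <;> omega

lemma fairCoin_cyl (X : Cantor) (n : ℕ) :
    fairCoin (PiNat.cylinder X n) = (2⁻¹ : ENNReal) ^ n := by
  have hm : MeasurableSet (PiNat.cylinder X n) :=
    (PiNat.isOpen_cylinder (fun _ => Bool) X n).measurableSet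
  have hd : fairCoin = Measure.map digitMap (volume.restrict (Set.Ico (0 : ℝ) 1)) := rfl
  rw [hd, Measure.map_apply measurable_digitMap hm,
    Measure.restrict_apply (measurable_digitMap hm)]
  obtain ⟨m, h0, h1, h⟩ := digit_prefix X n
  have hp : (0 : ℝ) < 2 ^ n := by positivity
  have : digitMap ⁻¹' PiNat.cylinder X n ∩ Set.Ico 0 1 =
      Set.Ico ((m : ℝ) / 2 ^ n) ((m + 1) / 2 ^ n) := by
    ext x
    have key : ⌊x * 2 ^ n⌋ = m ↔ x ∈ Set.Ico ((m : ℝ) / 2 ^ n) ((m + 1) / 2 ^ n) := by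
      rw [Int.floor_eq_iff, Set.mem_Ico, div_le_iff₀ hp, lt_div_iff₀ hp]
    constructor
    · rintro ⟨hx, hx'⟩
      exact key.1 ((h x hx').1 hx)
    · intro hx
      have hx' : x ∈ Set.Ico (0 : ℝ) 1 := by
        refine ⟨le_trans (by positivity) hx.1, hx.2.trans_le ?_⟩
        rw [div_le_one hp]
        exact_mod_cast h1
      exact ⟨(h x hx').2 (key.2 hx), hx'⟩
  rw [this, Real.volume_Ico, show ((m : ℝ) + 1) / 2 ^ n - m / 2 ^ n = (2⁻¹) ^ n by
    rw [inv_pow]; field_simp; ring, ENNReal.ofReal_pow (by norm_num),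
    ENNReal.ofReal_inv_of_pos (by norm_num)]
  simp

/-- A single fair coin. -/
noncomputable def coin : Measure Bool := (PMF.uniformOfFintype Bool).toMeasure

instance : IsProbabilityMeasure coin := by unfold coin; infer_instance

lemma coin_singleton (b : Bool) : coin {b} = 2⁻¹ := by
  unfold coin
  rw [PMF.toMeasure_apply_singleton _ _ (measurableSet_singleton b)]
  simp

lemma fairCoin_eq : fairCoin = Measure.infinitePi (fun _ : ℕ => coin) := by
  symm
  refine ext_of_generate_finite
    { s : Set (ℕ → Bool) | ∃ (x : ℕ → Bool) (n : ℕ), s = PiNat.cylinder x n } ?_ ?_ ?_ ?_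
  · rw [BorelSpace.measurable_eq (α := ℕ → Bool)]
    exact (PiNat.isTopologicalBasis_cylinders (fun _ => Bool)).borel_eq_generateFrom
  · rintro _ ⟨x, n, rfl⟩ _ ⟨y, m, rfl⟩ ⟨z, hz1, hz2⟩
    refine ⟨z, max n m, ?_⟩
    ext w
    simp only [Set.mem_inter_iff, PiNat.mem_cylinder_iff] at *
    grind
  · rintro _ ⟨x, n, rfl⟩
    rw [fairCoin_cyl, PiNat.cylinder_eq_pi, Measure.infinitePi_pi _ (by simp)]
    simp [coin_singleton]
  · have h0 := fairCoin_cyl (fun _ => false) 0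
    simp at h0
    simp [h0]

lemma fairCoin_map (k : ℕ → ℕ) (hk : Function.Injective k) :
    fairCoin.map (fun X n => X (k n)) = fairCoin := by
  classical
  rw [fairCoin_eq]
  refine Measure.eq_infinitePi _ fun s t ht => ?_
  have hT : Measurable (fun (X : ℕ → Bool) n => X (k n)) := by fun_prop
  rw [Measure.map_apply hT (MeasurableSet.pi s.countable_toSet fun i _ => ht i)]
  have : (fun (X : ℕ → Bool) n => X (k n)) ⁻¹' Set.pi s t =
      Set.pi ((s.image k : Finset ℕ) : Set ℕ) (fun j => t (Function.invFun k j)) := by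
    ext X
    simp [Set.mem_pi, Function.leftInverse_invFun hk _]
  rw [this, Measure.infinitePi_pi _ (fun i _ => ht _), Finset.prod_image (fun a _ b _ h => hk h)]
  simp [Function.leftInverse_invFun hk _]

/-- Does `τ` decide that `X ∘ k` extends `σ` for `X` extending `τ`? -/
def chk (k : ℕ → ℕ) (p : List Bool × List Bool) : Bool :=
  Nat.rec (motive := fun _ => Bool) true
    (fun i b => b && decide (p.2[k i]? = p.1[i]?)) p.1.length

lemma chk_iff (k : ℕ → ℕ) (σ τ : List Bool) :
    chk k (σ, τ) = true ↔ ∀ i < σ.length, τ[k i]? = σ[i]? := by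
  unfold chk
  simp only
  generalize σ.length = n
  induction n with
  | zero => simp
  | succ n ih => simp only [Bool.and_eq_true, ih, decide_eq_true_eq, Nat.forall_lt_succ_right]

lemma chk_comp (k : ℕ → ℕ) (hk : Computable k) : Computable (chk k) := by
  refine Computable.nat_rec (f := fun p : List Bool × List Bool => p.1.length)
    (g := fun _ => true)
    (h := fun p q => q.2 && decide (p.2[k q.1]? = p.1[q.1]?))
    (Computable.list_length.comp Computable.fst) (Computable.const true) ?_
  have hand : Computable₂ (fun a b : Bool => a && b) := Primrec.and.to_comp
  have heq : Computable₂ (fun a b : Option Bool => decide (a = b)) :=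
    (Primrec.eq (α := Option Bool)).decide.to_comp
  refine hand.comp (Computable.snd.comp Computable.snd) (heq.comp ?_ ?_)
  · exact Computable.list_getElem?.comp (Computable.snd.comp Computable.fst)
      (hk.comp (Computable.fst.comp Computable.snd))
  · exact Computable.list_getElem?.comp (Computable.fst.comp Computable.fst)
      (Computable.fst.comp Computable.snd)

/-- The pulled-back test. -/
def pullTest (k : ℕ → ℕ) (U : ℕ → ℕ → Option (List Bool)) (n m : ℕ) : Option (List Bool) :=
  (U n m.unpair.1).bind fun σ =>
    (Encodable.decode (α := List Bool) m.unpair.2).bind fun τ =>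
      cond (chk k (σ, τ)) (some τ) none

lemma pullTest_comp (k : ℕ → ℕ) (hk : Computable k) (U : ℕ → ℕ → Option (List Bool))
    (hU : Computable₂ U) : Computable₂ (pullTest k U) := by
  have hu : Computable Nat.unpair := Primrec.unpair.to_comp
  refine Computable.option_bind (f := fun p : ℕ × ℕ => U p.1 p.2.unpair.1)
    (hU.comp Computable.fst (Computable.fst.comp (hu.comp Computable.snd))) ?_
  refine Computable.option_bind
    (f := fun q : (ℕ × ℕ) × List Bool => Encodable.decode (α := List Bool) q.1.2.unpair.2)
    (Computable.decode.comp
      (Computable.snd.comp (hu.comp (Computable.snd.comp Computable.fst)))) ?_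
  refine Computable.cond
    ((chk_comp k hk).comp ((Computable.snd.comp Computable.fst).pair Computable.snd))
    (Computable.option_some.comp Computable.snd) (Computable.const none)

lemma mem_testSet (U : ℕ → ℕ → Option (List Bool)) (n : ℕ) (X : Cantor) :
    X ∈ testSet U n ↔ ∃ j σ, U n j = some σ ∧ ∀ i < σ.length, some (X i) = σ[i]? := by
  simp only [testSet, _root_.cylinder, Set.mem_iUnion, Set.mem_setOf_eq]
  constructor
  · rintro ⟨σ, ⟨j, hj⟩, h⟩
    refine ⟨j, σ, hj, fun i hi => ?_⟩
    rw [h i hi]; simp [hi]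
  · rintro ⟨j, σ, hj, h⟩
    refine ⟨σ, ⟨j, hj⟩, fun i hi => ?_⟩
    have := h i hi
    simpa [hi] using this

lemma pullTest_set (k : ℕ → ℕ) (U : ℕ → ℕ → Option (List Bool)) (n : ℕ) :
    testSet (pullTest k U) n = (fun (X : Cantor) i => X (k i)) ⁻¹' testSet U n := by
  ext X
  rw [Set.mem_preimage, mem_testSet, mem_testSet]
  constructor
  · rintro ⟨m, τ, hm, hX⟩
    unfold pullTest at hm
    obtain ⟨σ, hσ, hm⟩ := Option.bind_eq_some_iff.1 hm
    obtain ⟨τ', hτ, hm⟩ := Option.bind_eq_some_iff.1 hm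
    cases hc : chk k (σ, τ') with
    | false => simp [hc] at hm
    | true =>
      simp [hc] at hm
      subst hm
      rw [chk_iff] at hc
      refine ⟨_, σ, hσ, fun i hi => ?_⟩
      rw [← hc i hi]
      apply hX
      by_contra hlt
      have := hc i hi
      rw [List.getElem?_eq_none (not_lt.1 hlt)] at this
      simp [hi] at this
  · rintro ⟨j, σ, hj, hX⟩
    obtain ⟨N, hN⟩ : ∃ N, ∀ i < σ.length, k i < N := by
      refine ⟨(Finset.range σ.length).sup k + 1, fun i hi => Nat.lt_succ_of_le ?_⟩
      exact Finset.le_sup (f := k) (Finset.mem_range.2 hi)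
    let τ : List Bool := List.ofFn (fun i : Fin N => X i)
    refine ⟨Nat.pair j (Encodable.encode τ), τ, ?_, ?_⟩
    · have hc : chk k (σ, τ) = true := by
        rw [chk_iff]
        intro i hi
        rw [← hX i hi]
        simp [τ, hN i hi]
      simp [pullTest, hj, hc]
    · intro i hi
      simp [τ] at hi
      simp [τ, hi]

lemma measurable_testSet (U : ℕ → ℕ → Option (List Bool)) (n : ℕ) :
    MeasurableSet (testSet U n) := by
  refine MeasurableSet.biUnion (Set.to_countable _) fun σ _ => ?_
  have : _root_.cylinder σ =
      ⋂ (i : ℕ) (h : i < σ.length), {X : Cantor | X i = σ.get ⟨i, h⟩} := by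
    ext X; simp [_root_.cylinder]
  rw [this]
  refine MeasurableSet.iInter fun i => MeasurableSet.iInter fun h => ?_
  exact (measurable_pi_apply i) (measurableSet_singleton _)

lemma mlr_comp (k : ℕ → ℕ) (hk : Computable k) (hinj : Function.Injective k) (X : Cantor)
    (hX : X ∈ MLR) : (fun n => X (k n)) ∈ MLR := by
  intro U hU
  have hV : MLTest (pullTest k U) := by
    refine ⟨pullTest_comp k hk U hU.1, fun n => ?_⟩
    have hT : Measurable (fun (X : Cantor) n => X (k n)) :=
      measurable_pi_iff.2 fun n => measurable_pi_apply (k n)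
    rw [pullTest_set, ← Measure.map_apply hT (measurable_testSet U n), fairCoin_map k hinj]
    exact hU.2 n
  obtain ⟨n, hn⟩ := hX _ hV
  refine ⟨n, fun h => hn ?_⟩
  rw [pullTest_set]
  exact h

lemma find_comp (f : ℕ → ℕ) (hf : Computable f) (hub : ∀ m, ∃ k, f k > m) :
    Computable (fun y => Nat.find (hub y)) := by
  have hlt : Computable₂ (fun a b : ℕ => decide (a < b)) := Primrec.nat_lt.decide.to_comp
  have hp : Computable₂ (fun y k : ℕ => decide (y < f k)) :=
    hlt.comp Computable.fst (hf.comp Computable.snd)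
  refine (Partrec.rfind hp.partrec₂).of_eq fun y => ?_
  refine Part.eq_some_iff.2 (Nat.mem_rfind.2 ⟨?_, fun {m} hm => ?_⟩)
  · simpa using Nat.find_spec (hub y)
  · simpa using Nat.find_min (hub y) hm

/-- The indices at which `g` samples `f`. -/
def idx (f : ℕ → ℕ) (hub : ∀ m, ∃ k, f k > m) (n : ℕ) : ℕ :=
  Nat.rec (motive := fun _ => ℕ) 0 (fun _ k => Nat.find (hub (f k))) n

lemma idx_comp (f : ℕ → ℕ) (hf : Computable f) (hub : ∀ m, ∃ k, f k > m) :
    Computable (idx f hub) := by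
  refine Computable.nat_rec (f := fun n : ℕ => n) (g := fun _ => 0)
    (h := fun _ q => Nat.find (hub (f q.2))) Computable.id (Computable.const 0) ?_
  exact (find_comp f hf hub).comp (hf.comp (Computable.snd.comp Computable.snd))

lemma idx_max (f : ℕ → ℕ) (hub : ∀ m, ∃ k, f k > m) (n : ℕ) :
    ∀ j ≤ idx f hub n, f j ≤ f (idx f hub n) := by
  induction n with
  | zero => intro j hj; have : j = 0 := Nat.le_zero.1 hj; subst this; exact le_rfl
  | succ n _ =>
    intro j hj
    change j ≤ Nat.find (hub (f (idx f hub n))) at hj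
    change f j ≤ f (Nat.find (hub (f (idx f hub n))))
    rcases hj.lt_or_eq with h | h
    · have h1 := Nat.find_min (hub (f (idx f hub n))) h
      have h2 := Nat.find_spec (hub (f (idx f hub n)))
      omega
    · rw [← h]

lemma idx_strictMono (f : ℕ → ℕ) (hub : ∀ m, ∃ k, f k > m) : StrictMono (idx f hub) := by
  refine strictMono_nat_of_lt_succ fun n => ?_
  by_contra h
  have h1 := idx_max f hub n _ (not_lt.1 h)
  have h2 : f (idx f hub (n + 1)) > f (idx f hub n) := Nat.find_spec (hub (f (idx f hub n)))
  omega

/-- If `f` is computable and unbounded, and `g(0) = f(0)`,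
`g(n+1) = f(μk.(f(k) > g(n)))`, then `A∘f ∈ MLR` implies `A∘g ∈ MLR`. -/
theorem comp_f_mlr_implies_comp_g_mlr (f : ℕ → ℕ) (hf : Computable f)
    (hub : ∀ m, ∃ k, f k > m) (g : ℕ → ℕ) (hg0 : g 0 = f 0)
    (hgs : ∀ n, g (n + 1) = f (Nat.find (hub (g n))))
    (A : Cantor) (hA : (fun n => A (f n)) ∈ MLR) :
    (fun n => A (g n)) ∈ MLR := by
  have hg : ∀ n, g n = f (idx f hub n) := by
    intro n
    induction n with
    | zero => exact hg0
    | succ n ih =>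
      rw [hgs]
      simp only [ih]
      rfl
  have := mlr_comp (idx f hub) (idx_comp f hf hub) (idx_strictMono f hub).injective _ hA
  simpa only [hg] using this
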